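/- (MacMahon Master Theorem, first form) For any k \ge 1 and any q-super Manin matrix M, \sum_{r=0}^k (-1)^r str_{1,...,k}(\mathcal{H}_r^q \mathcal{A}^q_{\{r+1,...,k\}} M_1 \cdots M_k) = 0 in the superalgebra A. -/

import Mathlib

open scoped BigOperators Classical
open Finset

namespace QSM

/-- Parity of a basis index of `ℂ^{m|n}`: `0` (even) for indices `< m`, `1` (odd) otherwise. -/
def pa (m : ℕ) {N : ℕ} (i : Fin N) : ℕ := if (i : ℕ) < m then 0 else 1

/-- The sign `ε(i - j)`: `1` if `i > j`, `0` if `i = j`, `-1` if `i < j`. -/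
def eps {N : ℕ} (i j : Fin N) : ℤ :=
  if (j : ℕ) < (i : ℕ) then 1 else if (i : ℕ) < (j : ℕ) then -1 else 0

variable {B : Type*} [Ring B] [Algebra ℂ B]

/-- Map a complex matrix into a matrix over the `ℂ`-algebra `B`. -/
noncomputable def cmap {I : Type*} (X : Matrix I I ℂ) : Matrix I I B :=
  X.map (algebraMap ℂ B)

/-- The super tensor product `E_{ij} ⊗ E_{kl}` of matrix units, as an operator on the
graded tensor square of `ℂ^{m|n}` (super sign conventions). -/
noncomputable def stu (m : ℕ) {N : ℕ} (i j k l : Fin N) :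
    Matrix (Fin N × Fin N) (Fin N × Fin N) ℂ :=
  Matrix.of fun p r =>
    ((-1 : ℂ) ^ ((pa m k + pa m l) * pa m r.1)) *
      (if p.1 = i ∧ r.1 = j then 1 else 0) * (if p.2 = k ∧ r.2 = l then 1 else 0)

/-- The operator `P^q = ∑_{i,j} q^{ε(i-j)} (-1)^{\bar j} E_{ij} ⊗ E_{ji}` on
`(ℂ^{m|n})^{⊗2}`. -/
noncomputable def Pq (q : ℂ) (m : ℕ) {N : ℕ} : Matrix (Fin N × Fin N) (Fin N × Fin N) ℂ :=
  ∑ i : Fin N, ∑ j : Fin N, (q ^ eps i j * (-1 : ℂ) ^ pa m j) • stu m i j j i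

/-- `M₁ = ∑ (-1)^{\bar i\bar j+\bar j} M_{ij} ⊗ E_{ij} ⊗ 1` on the tensor square. -/
noncomputable def Mone (m : ℕ) {N : ℕ} (M : Matrix (Fin N) (Fin N) B) :
    Matrix (Fin N × Fin N) (Fin N × Fin N) B :=
  Matrix.of fun p r =>
    if p.2 = r.2 then
      ((-1 : ℂ) ^ (pa m p.1 * pa m r.1 + pa m r.1)) • M p.1 r.1
    else 0

/-- `M₂ = ∑ (-1)^{\bar i\bar j+\bar j} M_{ij} ⊗ 1 ⊗ E_{ij}` on the tensor square
(with the super sign of `1 ⊗ E_{ij}`). -/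
noncomputable def Mtwo (m : ℕ) {N : ℕ} (M : Matrix (Fin N) (Fin N) B) :
    Matrix (Fin N × Fin N) (Fin N × Fin N) B :=
  Matrix.of fun p r =>
    if p.1 = r.1 then
      ((-1 : ℂ) ^ (pa m p.2 * pa m r.2 + pa m r.2 + (pa m p.2 + pa m r.2) * pa m r.1)) •
        M p.2 r.2
    else 0

/-- The `q`-super Manin matrix condition in matrix form:
`(1 - P^q) M₁ M₂ (1 + P^q) = 0`. -/
def IsManin (q : ℂ) (m : ℕ) {N : ℕ} (M : Matrix (Fin N) (Fin N) B) : Prop :=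
  (1 - cmap (Pq q m)) * Mone m M * Mtwo m M * (1 + cmap (Pq q m)) = 0

/-- The entrywise relations of the right quantum superalgebra `𝓜_{m|n}`. -/
def ManinRel (q : ℂ) (m : ℕ) {N : ℕ} (M : Matrix (Fin N) (Fin N) B) : Prop :=
  (∀ i j, pa m i = 1 → pa m j = 0 → M i j * M i j = 0) ∧
  (∀ i k l, pa m i = 1 →
    M i k * M i l = (q ^ eps l k * (-1 : ℂ) ^ ((pa m k + 1) * (pa m l + 1))) • (M i l * M i k)) ∧
  (∀ i j k, pa m k = 0 →
    M i k * M j k = (q ^ eps i j * (-1 : ℂ) ^ (pa m i * pa m j)) • (M j k * M i k)) ∧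
  (∀ i j k l,
    M i j * M k l -
        (q ^ (eps i k + eps l j) * (-1 : ℂ) ^ ((pa m i + pa m j) * (pa m k + pa m l))) •
          (M k l * M i j)
      = (q ^ eps i k * (-1 : ℂ) ^ (pa m i * pa m k + pa m j * pa m k + pa m i * pa m j)) •
            (M k j * M i l)
        - (q ^ eps l j * (-1 : ℂ) ^ (pa m j * pa m k + pa m j * pa m l + pa m k * pa m l)) •
            (M i l * M k j))

/-- The operator `P^q_σ` on `(ℂ^{m|n})^{⊗k}` (defined via reduced decompositions of `σ`;
equivalently, by the explicit inversion formula used here). -/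
noncomputable def Pperm (q : ℂ) (m : ℕ) {N k : ℕ} (σ : Equiv.Perm (Fin k)) :
    Matrix (Fin k → Fin N) (Fin k → Fin N) ℂ :=
  Matrix.of fun f g =>
    if f = g ∘ ⇑σ⁻¹ then
      ∏ p ∈ Finset.univ.filter (fun p : Fin k × Fin k => p.1 < p.2 ∧ σ p.2 < σ p.1),
        (q ^ eps (g p.1) (g p.2) * (-1 : ℂ) ^ (pa m (g p.1) * pa m (g p.2)))
    else 0

/-- The `q`-antisymmetrizer over the tensor positions in `S`. -/
noncomputable def AqS (q : ℂ) (m : ℕ) {N k : ℕ} (S : Finset (Fin k)) :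
    Matrix (Fin k → Fin N) (Fin k → Fin N) ℂ :=
  (S.card.factorial : ℂ)⁻¹ •
    ∑ σ ∈ Finset.univ.filter (fun σ : Equiv.Perm (Fin k) => ∀ t ∉ S, σ t = t),
      (((Equiv.Perm.sign σ : ℤ) : ℂ)) • Pperm q m (N := N) σ

/-- The `q`-symmetrizer over the tensor positions in `S`. -/
noncomputable def HqS (q : ℂ) (m : ℕ) {N k : ℕ} (S : Finset (Fin k)) :
    Matrix (Fin k → Fin N) (Fin k → Fin N) ℂ :=
  (S.card.factorial : ℂ)⁻¹ •
    ∑ σ ∈ Finset.univ.filter (fun σ : Equiv.Perm (Fin k) => ∀ t ∉ S, σ t = t),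
      Pperm q m (N := N) σ

/-- `M_a`: the copy of `M` in the `a`-th slot of `B ⊗ End(ℂ^{m|n})^{⊗k}`, with the super
sign factors `(-1)^{\bar i\bar j+\bar j}` and the super signs of `1⊗⋯⊗E_{ij}⊗⋯⊗1`. -/
noncomputable def Mslot (m : ℕ) {N k : ℕ} (M : Matrix (Fin N) (Fin N) B) (a : Fin k) :
    Matrix (Fin k → Fin N) (Fin k → Fin N) B :=
  Matrix.of fun f g =>
    if ∀ b, b ≠ a → f b = g b then
      ((-1 : ℂ) ^ (pa m (f a) * pa m (g a) + pa m (g a)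
          + (pa m (f a) + pa m (g a)) *
              ∑ b ∈ Finset.univ.filter (fun b => b < a), pa m (g b))) •
        M (f a) (g a)
    else 0

/-- The product `M₁ M₂ ⋯ M_k`. -/
noncomputable def MProd (m : ℕ) {N : ℕ} (M : Matrix (Fin N) (Fin N) B) (k : ℕ) :
    Matrix (Fin k → Fin N) (Fin k → Fin N) B :=
  (List.ofFn fun a : Fin k => Mslot m M a).prod

/-- The `q`-super Manin condition in the form `𝒜₂^q M₁ M₂ ℋ₂^q = 0`. -/
def IsManin2 (q : ℂ) (m : ℕ) {N : ℕ} (M : Matrix (Fin N) (Fin N) B) : Prop :=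
  cmap (AqS q m (Finset.univ : Finset (Fin 2))) * Mslot m M (0 : Fin 2) *
      Mslot m M (1 : Fin 2) * cmap (HqS q m (Finset.univ : Finset (Fin 2))) = 0

/-- The supertrace `str_{1,…,k}` over all `k` tensor slots. -/
noncomputable def strAll (m : ℕ) {N k : ℕ}
    (X : Matrix (Fin k → Fin N) (Fin k → Fin N) B) : B :=
  ∑ f : Fin k → Fin N, ((-1 : ℂ) ^ (∑ t, pa m (f t))) • X f f

/-- The supertrace of an `N × N` matrix. -/
noncomputable def strM (m : ℕ) {N : ℕ} (X : Matrix (Fin N) (Fin N) B) : B :=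
  ∑ i, ((-1 : ℂ) ^ pa m i) • X i i

/-- The star product `B * C = str₁ (P^q_{12} B₁ C₂)`. -/
noncomputable def starMul (q : ℂ) (m : ℕ) {N : ℕ} (X Y : Matrix (Fin N) (Fin N) B) :
    Matrix (Fin N) (Fin N) B :=
  Matrix.of fun i j =>
    ((-1 : ℂ) ^ (pa m i * pa m j + pa m j)) •
      ∑ a : Fin N, ((-1 : ℂ) ^ (pa m a * (1 + pa m i + pa m j))) •
        ((cmap (Pperm q m (Equiv.swap (0 : Fin 2) 1)) * Mslot m X (0 : Fin 2) *
            Mslot m Y (1 : Fin 2) :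
          Matrix (Fin 2 → Fin N) (Fin 2 → Fin N) B) ![a, i] ![a, j])

/-- The powers `M^{[k]}` of `M` with respect to the star product. -/
noncomputable def Mpow (q : ℂ) (m : ℕ) {N : ℕ} (M : Matrix (Fin N) (Fin N) B) :
    ℕ → Matrix (Fin N) (Fin N) B
  | 0 => 1
  | 1 => M
  | (j + 2) => starMul q m (Mpow q m M (j + 1)) M

/-- Coefficient of `t^k` in `A(t) = ∑ (-t)^k str_{1,…,k}(𝒜_k^q M₁⋯M_k)`. -/
noncomputable def coefA (q : ℂ) (m : ℕ) {N : ℕ} (M : Matrix (Fin N) (Fin N) B) (k : ℕ) : B :=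
  ((-1 : ℂ) ^ k) •
    strAll m (cmap (AqS q m (Finset.univ : Finset (Fin k))) * MProd m M k)

/-- Coefficient of `t^k` in `S(t) = ∑ t^k str_{1,…,k}(ℋ_k^q M₁⋯M_k)`. -/
noncomputable def coefS (q : ℂ) (m : ℕ) {N : ℕ} (M : Matrix (Fin N) (Fin N) B) (k : ℕ) : B :=
  strAll m (cmap (HqS q m (Finset.univ : Finset (Fin k))) * MProd m M k)

/-- Coefficient of `t^k` in `T(t) = ∑ t^k str(M^{[k+1]})`. -/
noncomputable def coefT (q : ℂ) (m : ℕ) {N : ℕ} (M : Matrix (Fin N) (Fin N) B) (k : ℕ) : B :=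
  strM m (Mpow q m M (k + 1))

/-- Coefficients `M^{i_1…i_k}_{j_1…j_k}` of `𝒜_k^q M₁⋯M_k` in the basis
`E_{i_1j_1} ⊗ ⋯ ⊗ E_{i_kj_k}` (super sign conventions). -/
noncomputable def MIJ (q : ℂ) (m : ℕ) {N k : ℕ} (M : Matrix (Fin N) (Fin N) B)
    (f g : Fin k → Fin N) : B :=
  ((-1 : ℂ) ^ (∑ a : Fin k, (pa m (f a) + pa m (g a)) *
      ∑ b ∈ Finset.univ.filter (fun b => b < a), pa m (g b))) •
    ((cmap (AqS q m (Finset.univ : Finset (Fin k))) * MProd m M k :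
      Matrix (Fin k → Fin N) (Fin k → Fin N) B) f g)

/-- Number of inversions (the length `l(σ)`) of a permutation. -/
def invCount {r : ℕ} (σ : Equiv.Perm (Fin r)) : ℕ :=
  (Finset.univ.filter fun p : Fin r × Fin r => p.1 < p.2 ∧ σ p.2 < σ p.1).card

/-- The quantum determinant `det_q(A) = ∑_σ (-q)^{-l(σ)} A_{σ(1),1} ⋯ A_{σ(r),r}`. -/
noncomputable def detq (q : ℂ) {r : ℕ} (A : Matrix (Fin r) (Fin r) B) : B :=
  ∑ σ : Equiv.Perm (Fin r),
    ((-q) ^ (-(invCount σ : ℤ))) • (List.ofFn fun i : Fin r => A (σ i) i).prod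

/-- The quantum Berezinian of a type `(r|s)` matrix `A` with (two-sided) inverse `Ainv`. -/
noncomputable def Ber (q : ℂ) (r s : ℕ) (A Ainv : Matrix (Fin (r + s)) (Fin (r + s)) B) : B :=
  (∑ σ : Equiv.Perm (Fin r), ((-q) ^ (-(invCount σ : ℤ))) •
      (List.ofFn fun i : Fin r => A (Fin.castAdd s (σ i)) (Fin.castAdd s i)).prod) *
  (∑ ρ : Equiv.Perm (Fin s), ((-q) ^ (-(invCount ρ : ℤ))) •
      (List.ofFn fun j : Fin s => Ainv (Fin.natAdd r j) (Fin.natAdd r (ρ j))).prod)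

/-- The `Π ∘ st` transform of a type `(r'|s')` matrix: a type `(s'|r')` matrix. -/
noncomputable def PiSt (r' s' : ℕ) (A : Matrix (Fin (r' + s')) (Fin (r' + s')) B) :
    Matrix (Fin (s' + r')) (Fin (s' + r')) B :=
  Matrix.of fun i j =>
    ((-1 : ℂ) ^ (pa s' i * (pa s' i + pa s' j))) •
      A (Fin.rev (Fin.cast (Nat.add_comm s' r') j)) (Fin.rev (Fin.cast (Nat.add_comm s' r') i))

/-- Left corner embedding `Fin a → Fin b`. -/
def embL (a b : ℕ) (h : a ≤ b) : Fin a → Fin b :=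
  fun i => ⟨(i : ℕ), lt_of_lt_of_le i.isLt h⟩

/-- Embedding of `Fin a` into `Fin b` shifted by `c`. -/
def embR (c a b : ℕ) (h : c + a ≤ b) : Fin a → Fin b :=
  fun i => ⟨c + (i : ℕ), by have := i.isLt; omega⟩

/-- `P^q ⊗ 1` on the triple tensor space. -/
noncomputable def P12 (q : ℂ) (m : ℕ) {N : ℕ} :
    Matrix (Fin N × Fin N × Fin N) (Fin N × Fin N × Fin N) ℂ :=
  Matrix.of fun p r =>
    Pq q m (p.1, p.2.1) (r.1, r.2.1) * (if p.2.2 = r.2.2 then 1 else 0)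

/-- `1 ⊗ P^q` on the triple tensor space (no extra super sign: `P^q` is even). -/
noncomputable def P23 (q : ℂ) (m : ℕ) {N : ℕ} :
    Matrix (Fin N × Fin N × Fin N) (Fin N × Fin N × Fin N) ℂ :=
  Matrix.of fun p r =>
    (if p.1 = r.1 then 1 else 0) * Pq q m (p.2.1, p.2.2) (r.2.1, r.2.2)

section Symmetrizer

variable {k : ℕ} {R : Type*} [Ring R] [Algebra ℂ R]

/-- The normalized sum of `ρ σ` over the permutations `σ` supported in `S`. -/
noncomputable def permSym (ρ : Equiv.Perm (Fin k) →* R) (S : Finset (Fin k)) : R :=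
  (S.card.factorial : ℂ)⁻¹ •
    ∑ σ ∈ Finset.univ.filter (fun σ : Equiv.Perm (Fin k) => ∀ t ∉ S, σ t = t), ρ σ

/-- The twist of a representation by the sign character. -/
noncomputable def signTwist (ρ : Equiv.Perm (Fin k) →* R) : Equiv.Perm (Fin k) →* R where
  toFun σ := ((Equiv.Perm.sign σ : ℤ) : ℂ) • ρ σ
  map_one' := by simp
  map_mul' σ τ := by simp [smul_smul, mul_comm]

theorem signTwist_swap (ρ : Equiv.Perm (Fin k) →* R) {s t : Fin k} (h : s ≠ t) :
    signTwist ρ (Equiv.swap s t) = -ρ (Equiv.swap s t) := by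
  simp [signTwist, Equiv.Perm.sign_swap h]

theorem card_perm_supported (S : Finset (Fin k)) :
    (Finset.univ.filter (fun σ : Equiv.Perm (Fin k) => ∀ t ∉ S, σ t = t)).card =
      S.card.factorial := by
  have h := Fintype.card_congr (Equiv.Perm.subtypeEquivSubtypePerm (fun t => t ∈ S))
  rw [Fintype.card_perm, Fintype.card_coe, Fintype.card_subtype] at h
  rw [h]

theorem permSym_empty (ρ : Equiv.Perm (Fin k) →* R) : permSym ρ ∅ = 1 := by
  have : Finset.univ.filter (fun σ : Equiv.Perm (Fin k) => ∀ t ∉ (∅ : Finset (Fin k)), σ t = t)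
      = {1} := by
    ext σ
    simp [Equiv.ext_iff]
  rw [permSym, this]
  simp

theorem mul_permSym_of_supported (ρ : Equiv.Perm (Fin k) →* R) {S : Finset (Fin k)}
    {σ : Equiv.Perm (Fin k)} (hσ : ∀ t ∉ S, σ t = t) : ρ σ * permSym ρ S = permSym ρ S := by
  rw [permSym, mul_smul_comm, Finset.mul_sum]
  congr 1
  refine Finset.sum_equiv (Equiv.mulLeft σ) (fun τ => ?_) (fun τ _ => by simp)
  simp only [Finset.mem_filter, Finset.mem_univ, true_and, Equiv.coe_mulLeft, Equiv.Perm.mul_apply]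
  refine forall₂_congr fun t ht => ⟨fun h => by rw [h, hσ t ht], fun h => ?_⟩
  exact σ.injective (by rw [h, hσ t ht])

theorem permSym_mul_of_supported (ρ : Equiv.Perm (Fin k) →* R) {S : Finset (Fin k)}
    {σ : Equiv.Perm (Fin k)} (hσ : ∀ t ∉ S, σ t = t) : permSym ρ S * ρ σ = permSym ρ S := by
  rw [permSym, smul_mul_assoc, Finset.sum_mul]
  congr 1
  refine Finset.sum_equiv (Equiv.mulRight σ) (fun τ => ?_) (fun τ _ => by simp)
  simp only [Finset.mem_filter, Finset.mem_univ, true_and, Equiv.coe_mulRight,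
    Equiv.Perm.mul_apply]
  exact forall₂_congr fun t ht => by rw [hσ t ht]

theorem supported_swap {S : Finset (Fin k)} {s t : Fin k} (hs : s ∈ S) (ht : t ∈ S) :
    ∀ u ∉ S, Equiv.swap s t u = u := fun _ hu =>
  Equiv.swap_apply_of_ne_of_ne (fun h => hu (h ▸ hs)) (fun h => hu (h ▸ ht))

theorem smul_sum_supported (S : Finset (Fin k)) (x : R) :
    (S.card.factorial : ℂ)⁻¹ •
      ∑ _σ ∈ Finset.univ.filter (fun σ : Equiv.Perm (Fin k) => ∀ t ∉ S, σ t = t), x = x := by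
  rw [Finset.sum_const, card_perm_supported, ← Nat.cast_smul_eq_nsmul ℂ, smul_smul,
    inv_mul_cancel₀ (by exact_mod_cast S.card.factorial_ne_zero), one_smul]

/-- Symmetrizing over a smaller set is absorbed by a larger symmetrizer. -/
theorem permSym_mul_permSym (ρ : Equiv.Perm (Fin k) →* R) {S U : Finset (Fin k)} (h : S ⊆ U) :
    permSym ρ S * permSym ρ U = permSym ρ U := by
  rw [permSym, smul_mul_assoc, Finset.sum_mul]
  refine Eq.trans ?_ (smul_sum_supported S (permSym ρ U))
  congr 1
  refine Finset.sum_congr rfl fun σ hσ => mul_permSym_of_supported ρ fun t ht => ?_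
  exact (Finset.mem_filter.1 hσ).2 t fun hS => ht (h hS)

theorem permSym_mul_permSym' (ρ : Equiv.Perm (Fin k) →* R) {S U : Finset (Fin k)} (h : S ⊆ U) :
    permSym ρ U * permSym ρ S = permSym ρ U := by
  conv_lhs => rw [permSym.eq_1 ρ S, mul_smul_comm, Finset.mul_sum]
  refine Eq.trans ?_ (smul_sum_supported S (permSym ρ U))
  congr 1
  refine Finset.sum_congr rfl fun σ hσ => permSym_mul_of_supported ρ fun t ht => ?_
  exact (Finset.mem_filter.1 hσ).2 t fun hS => ht (h hS)

/-- Coset decomposition of the symmetrizer over `insert t S`. -/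
theorem permSym_insert (ρ : Equiv.Perm (Fin k) →* R) {S : Finset (Fin k)} {t : Fin k}
    (ht : t ∉ S) :
    ((S.card : ℂ) + 1) • permSym ρ (insert t S) =
      ∑ u ∈ insert t S, ρ (Equiv.swap u t) * permSym ρ S := by
  have hfac : ((S.card : ℂ) + 1) * ((insert t S).card.factorial : ℂ)⁻¹ =
      (S.card.factorial : ℂ)⁻¹ := by
    rw [Finset.card_insert_of_notMem ht, Nat.factorial_succ]
    have h1 : ((S.card : ℂ) + 1) ≠ 0 := by exact_mod_cast S.card.succ_ne_zero
    push_cast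
    rw [mul_inv, mul_inv_cancel_left₀ h1]
  rw [permSym, smul_smul, hfac]
  simp only [permSym, mul_smul_comm]
  rw [← Finset.smul_sum]
  congr 1
  simp only [Finset.mul_sum]
  rw [← Finset.sum_product']
  refine Finset.sum_nbij' (fun σ => (σ t, Equiv.swap (σ t) t * σ))
    (fun p => Equiv.swap p.1 t * p.2) ?_ ?_ ?_ ?_ ?_
  · intro σ hσ
    have hσ := (Finset.mem_filter.1 hσ).2
    have hσt : σ t ∈ insert t S := by
      by_contra h
      have := σ.injective (hσ _ h)
      exact h (by rw [this]; exact Finset.mem_insert_self t S)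
    refine Finset.mem_product.2 ⟨hσt, Finset.mem_filter.2 ⟨Finset.mem_univ _, fun u hu => ?_⟩⟩
    by_cases hut : u = t
    · subst hut; simp
    · have hu' : u ∉ insert t S := by simp [hut, hu]
      rw [Equiv.Perm.mul_apply, hσ u hu']
      exact supported_swap hσt (Finset.mem_insert_self t S) u hu'
  · rintro ⟨u, τ⟩ h
    obtain ⟨hu, hτ⟩ := Finset.mem_product.1 h
    have hτ := (Finset.mem_filter.1 hτ).2
    refine Finset.mem_filter.2 ⟨Finset.mem_univ _, fun v hv => ?_⟩
    simp only [Equiv.Perm.mul_apply]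
    rw [hτ v fun h => hv (Finset.mem_insert_of_mem h)]
    exact supported_swap hu (Finset.mem_insert_self t S) v hv
  · intro σ _
    simp [← mul_assoc]
  · rintro ⟨u, τ⟩ h
    have hτ := (Finset.mem_filter.1 (Finset.mem_product.1 h).2).2 t ht
    simp [hτ, ← mul_assoc]
  · intro σ _
    simp [← map_mul, ← mul_assoc]

theorem permSym_insert_eq (ρ : Equiv.Perm (Fin k) →* R) {S : Finset (Fin k)} {s t : Fin k}
    (hs : s ∈ S) (ht : t ∉ S) :
    ((S.card : ℂ) + 1) • permSym ρ (insert t S) =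
      permSym ρ S + (S.card : ℂ) • (permSym ρ S * ρ (Equiv.swap s t) * permSym ρ S) := by
  rw [← permSym_mul_permSym ρ (Finset.subset_insert t S), ← mul_smul_comm, permSym_insert ρ ht,
    Finset.sum_insert ht, mul_add, Equiv.swap_self, Finset.mul_sum]
  have h1 : ρ (Equiv.refl (Fin k)) = 1 := map_one ρ
  rw [h1, one_mul, permSym_mul_permSym ρ subset_rfl]
  congr 1
  rw [Finset.sum_congr rfl (g := fun _ => permSym ρ S * ρ (Equiv.swap s t) * permSym ρ S),
    Finset.sum_const, ← Nat.cast_smul_eq_nsmul ℂ]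
  intro u hu
  have hst : s ≠ t := fun h => ht (h ▸ hs)
  have hut : u ≠ t := fun h => ht (h ▸ hu)
  have hconj : Equiv.swap u t = Equiv.swap s u * Equiv.swap s t * Equiv.swap s u := by
    have := Equiv.swap_apply_apply (Equiv.swap s u) s t
    rw [Equiv.swap_apply_left, Equiv.swap_apply_of_ne_of_ne hst.symm hut.symm] at this
    rw [this, Equiv.swap_inv]
  have hsu := supported_swap hs hu
  rw [hconj, map_mul, map_mul]
  calc permSym ρ S * (ρ (Equiv.swap s u) * ρ (Equiv.swap s t) * ρ (Equiv.swap s u) * permSym ρ S)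
      = (permSym ρ S * ρ (Equiv.swap s u)) * ρ (Equiv.swap s t) *
          (ρ (Equiv.swap s u) * permSym ρ S) := by simp only [mul_assoc]
    _ = _ := by rw [mul_permSym_of_supported ρ hsu, permSym_mul_of_supported ρ hsu]

theorem permSym_singleton (ρ : Equiv.Perm (Fin k) →* R) (t : Fin k) : permSym ρ {t} = 1 := by
  have h := permSym_insert ρ (Finset.notMem_empty t)
  have h1 : ρ (Equiv.refl (Fin k)) = 1 := map_one ρ
  simpa [permSym_empty, h1] using h

theorem permSym_commute (ρ : Equiv.Perm (Fin k) →* R) {S U : Finset (Fin k)}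
    (h : Disjoint S U) : Commute (permSym ρ S) (permSym (signTwist ρ) U) := by
  refine (Commute.sum_left _ _ _ fun σ hσ => ?_).smul_left _
  refine (Commute.sum_right _ _ _ fun τ hτ => ?_).smul_right _
  refine Commute.smul_right ?_ _
  refine Commute.map (f := ρ) (Equiv.Perm.Disjoint.commute fun t => ?_)
  by_cases hS : t ∈ S
  · exact Or.inr ((Finset.mem_filter.1 hτ).2 t (Finset.disjoint_left.1 h hS))
  · exact Or.inl ((Finset.mem_filter.1 hσ).2 t hS)

/-- If `T` is absorbed on the right by `ρ (swap s t)` after left symmetrization over `{s, t}`,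
then absorption by the symmetrizer extends from `S` to `insert t S`. -/
theorem permSym_mul_insert (ρ : Equiv.Perm (Fin k) →* R) {S : Finset (Fin k)} {s t : Fin k}
    (hs : s ∈ S) (ht : t ∉ S) {T : R}
    (hT : (1 + ρ (Equiv.swap s t)) * T * (1 - ρ (Equiv.swap s t)) = 0)
    (hS : permSym ρ S * T * permSym ρ S = permSym ρ S * T) :
    permSym ρ (insert t S) * T * permSym ρ (insert t S) = permSym ρ (insert t S) * T := by
  set E := permSym ρ (insert t S)
  set F := permSym ρ S
  set P := ρ (Equiv.swap s t)
  have hEF : E * F = E := permSym_mul_permSym' ρ (Finset.subset_insert t S)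
  have hEP : E * P = E := permSym_mul_of_supported ρ
    (supported_swap (Finset.mem_insert_of_mem hs) (Finset.mem_insert_self t S))
  have hETF : E * T * F = E * T := by
    rw [← hEF, mul_assoc E F T, mul_assoc E, hS]
  have hETP : E * T * P = E * T := by
    have h2 : E * ((1 + P) * T * (1 - P)) = (2 : ℂ) • (E * T - E * T * P) := by
      have : E * (1 + P) = (2 : ℂ) • E := by rw [mul_add, mul_one, hEP, two_smul]
      rw [← mul_assoc, ← mul_assoc, this, smul_mul_assoc, smul_mul_assoc, mul_sub, mul_one]
    rw [hT, mul_zero] at h2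
    have := (smul_eq_zero.1 h2.symm).resolve_left two_ne_zero
    exact (sub_eq_zero.1 this).symm
  have hc : ((S.card : ℂ) + 1) ≠ 0 := by exact_mod_cast S.card.succ_ne_zero
  refine smul_right_injective R hc ?_
  simp only
  rw [← mul_smul_comm, permSym_insert_eq ρ hs ht, mul_add, mul_smul_comm, ← mul_assoc, ← mul_assoc,
    hETF, hETP, hETF, add_smul, one_smul, add_comm]

theorem mul_permSym_insert (ρ : Equiv.Perm (Fin k) →* R) {S : Finset (Fin k)} {s t : Fin k}
    (hs : s ∈ S) (ht : t ∉ S) {T : R}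
    (hT : (1 - ρ (Equiv.swap s t)) * T * (1 + ρ (Equiv.swap s t)) = 0)
    (hS : permSym ρ S * T * permSym ρ S = T * permSym ρ S) :
    permSym ρ (insert t S) * T * permSym ρ (insert t S) = T * permSym ρ (insert t S) := by
  set E := permSym ρ (insert t S)
  set F := permSym ρ S
  set P := ρ (Equiv.swap s t)
  have hFE : F * E = E := permSym_mul_permSym ρ (Finset.subset_insert t S)
  have hPE : P * E = E := mul_permSym_of_supported ρ
    (supported_swap (Finset.mem_insert_of_mem hs) (Finset.mem_insert_self t S))
  have hFTE : F * (T * E) = T * E := by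
    rw [← hFE, ← mul_assoc T, ← mul_assoc F, ← mul_assoc F, hS]
  have hPTE : P * (T * E) = T * E := by
    have h2 : ((1 - P) * T * (1 + P)) * E = (2 : ℂ) • (T * E - P * (T * E)) := by
      have : (1 + P) * E = (2 : ℂ) • E := by rw [add_mul, one_mul, hPE, two_smul]
      rw [mul_assoc, this, mul_smul_comm, mul_assoc, sub_mul, one_mul]
    rw [hT, zero_mul] at h2
    have := (smul_eq_zero.1 h2.symm).resolve_left two_ne_zero
    exact (sub_eq_zero.1 this).symm
  have hc : ((S.card : ℂ) + 1) ≠ 0 := by exact_mod_cast S.card.succ_ne_zero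
  refine smul_right_injective R hc ?_
  simp only
  rw [mul_assoc, ← smul_mul_assoc, permSym_insert_eq ρ hs ht, add_mul, smul_mul_assoc, mul_assoc,
    mul_assoc, hFTE, hPTE, hFTE, add_smul, one_smul, add_comm]

theorem permSym_cyclic {V : Type*} [AddCommGroup V] [Module ℂ V] {φ : R →ₗ[ℂ] V}
    {ρ : Equiv.Perm (Fin k) →* R} (hφ : ∀ σ X, φ (ρ σ * X) = φ (X * ρ σ))
    (S : Finset (Fin k)) (X : R) : φ (permSym ρ S * X) = φ (X * permSym ρ S) := by
  simp [permSym, Finset.sum_mul, Finset.mul_sum, hφ]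

/-- Tensor positions before position `r` (counting from `0`). -/
def lowerSlots (k r : ℕ) : Finset (Fin k) := Finset.univ.filter fun t : Fin k => (t : ℕ) < r

/-- Tensor positions from position `r` on (counting from `0`). -/
def upperSlots (k r : ℕ) : Finset (Fin k) := Finset.univ.filter fun t : Fin k => r ≤ (t : ℕ)

theorem mem_lowerSlots {r : ℕ} {t : Fin k} : t ∈ lowerSlots k r ↔ (t : ℕ) < r := by
  simp [lowerSlots]

theorem mem_upperSlots {r : ℕ} {t : Fin k} : t ∈ upperSlots k r ↔ r ≤ (t : ℕ) := by
  simp [upperSlots]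

theorem lowerSlots_zero : lowerSlots k 0 = ∅ := by
  ext t; simp [mem_lowerSlots]

theorem upperSlots_self : upperSlots k k = ∅ := by
  ext t; simp [mem_upperSlots]

theorem lowerSlots_succ {r : ℕ} (h : r < k) :
    lowerSlots k (r + 1) = insert ⟨r, h⟩ (lowerSlots k r) := by
  ext t; simp only [mem_lowerSlots, Finset.mem_insert, Fin.ext_iff]; omega

theorem upperSlots_eq_insert {r : ℕ} (h : r < k) :
    upperSlots k r = insert ⟨r, h⟩ (upperSlots k (r + 1)) := by
  ext t; simp only [mem_upperSlots, Finset.mem_insert, Fin.ext_iff]; omega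

theorem card_lowerSlots {r : ℕ} (h : r ≤ k) : (lowerSlots k r).card = r := by
  induction r with
  | zero => simp [lowerSlots_zero]
  | succ r ih =>
    rw [lowerSlots_succ h, Finset.card_insert_of_notMem (by simp [mem_lowerSlots]), ih (by omega)]

theorem disjoint_slots {r : ℕ} : Disjoint (lowerSlots k r) (upperSlots k r) := by
  rw [Finset.disjoint_left]
  intro t; simp only [mem_lowerSlots, mem_upperSlots]; omega

theorem card_upperSlots {r : ℕ} (h : r ≤ k) : (upperSlots k r).card = k - r := by
  have hu : lowerSlots k r ∪ upperSlots k r = Finset.univ := by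
    ext t
    simp only [Finset.mem_union, mem_lowerSlots, mem_upperSlots, Finset.mem_univ, iff_true]
    omega
  have := Finset.card_union_of_disjoint (disjoint_slots (k := k) (r := r))
  rw [hu, card_lowerSlots h, Finset.card_univ, Fintype.card_fin] at this
  omega

theorem permSym_lowerSlots_absorb (ρ : Equiv.Perm (Fin k) →* R) {T : R}
    (hT : ∀ a b : Fin k, (a : ℕ) + 1 = b →
      (1 - ρ (Equiv.swap a b)) * T * (1 + ρ (Equiv.swap a b)) = 0) {r : ℕ} (hr : r ≤ k) :
    permSym ρ (lowerSlots k r) * T * permSym ρ (lowerSlots k r) =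
      T * permSym ρ (lowerSlots k r) := by
  induction r with
  | zero => simp [lowerSlots_zero, permSym_empty]
  | succ r ih =>
    rw [lowerSlots_succ hr]
    rcases r with _ | r
    · simp [lowerSlots_zero, permSym_singleton]
    · refine mul_permSym_insert ρ (s := ⟨r, by omega⟩) (by simp [mem_lowerSlots])
        (by simp [mem_lowerSlots]) (hT _ _ rfl) (ih (by omega))

theorem permSym_upperSlots_absorb (ρ : Equiv.Perm (Fin k) →* R) {T : R}
    (hT : ∀ a b : Fin k, (a : ℕ) + 1 = b →
      (1 + ρ (Equiv.swap a b)) * T * (1 - ρ (Equiv.swap a b)) = 0) {r : ℕ} (hr : r ≤ k) :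
    permSym ρ (upperSlots k r) * T * permSym ρ (upperSlots k r) =
      permSym ρ (upperSlots k r) * T := by
  induction hr using Nat.decreasingInduction with
  | self => simp [upperSlots_self, permSym_empty]
  | of_succ r hr ih =>
    rw [upperSlots_eq_insert hr]
    rcases (Nat.succ_le_of_lt hr).eq_or_lt with h | h
    · have : upperSlots k (r + 1) = ∅ := by
        ext t; simp only [mem_upperSlots, Finset.notMem_empty, iff_false]; omega
      simp [this, permSym_singleton]
    · refine permSym_mul_insert ρ (s := ⟨r + 1, h⟩) (by simp [mem_upperSlots])
        (by simp [mem_upperSlots]) ?_ ih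
      rw [Equiv.swap_comm]
      exact hT _ _ rfl

/-- The abstract form of the MacMahon Master Theorem: a tracial functional `φ` and an element `T`
satisfying the Manin relations for a representation `ρ` of the symmetric group. -/
theorem alternating_sum_permSym_eq_zero {V : Type*} [AddCommGroup V] [Module ℂ V]
    (φ : R →ₗ[ℂ] V) (ρ : Equiv.Perm (Fin k) →* R) (T : R) (hk : 1 ≤ k)
    (hφ : ∀ σ X, φ (ρ σ * X) = φ (X * ρ σ))
    (hT : ∀ a b : Fin k, (a : ℕ) + 1 = b →
      (1 - ρ (Equiv.swap a b)) * T * (1 + ρ (Equiv.swap a b)) = 0) :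
    ∑ r ∈ Finset.range (k + 1), ((-1 : ℂ) ^ r) •
      φ (permSym ρ (lowerSlots k r) * permSym (signTwist ρ) (upperSlots k r) * T) = 0 := by
  have hφ' : ∀ σ X, φ (signTwist ρ σ * X) = φ (X * signTwist ρ σ) := fun σ X => by
    simp [signTwist, hφ]
  have hT' : ∀ a b : Fin k, (a : ℕ) + 1 = b →
      (1 + signTwist ρ (Equiv.swap a b)) * T * (1 - signTwist ρ (Equiv.swap a b)) = 0 := by
    intro a b hab
    have hne : a ≠ b := fun h => by rw [h] at hab; omega
    rw [signTwist_swap ρ hne, sub_neg_eq_add, ← sub_eq_add_neg]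
    exact hT a b hab
  set H : ℕ → R := fun r => permSym ρ (lowerSlots k r) with hH
  set E : ℕ → R := fun r => permSym (signTwist ρ) (upperSlots k r) with hE
  have cycH : ∀ r X, φ (H r * X) = φ (X * H r) := fun r X => permSym_cyclic hφ _ X
  have cycE : ∀ r X, φ (E r * X) = φ (X * E r) := fun r X => permSym_cyclic hφ' _ X
  have absH : ∀ r ≤ k, H r * T * H r = T * H r := fun r hr => permSym_lowerSlots_absorb ρ hT hr
  have absE : ∀ r ≤ k, E r * T * E r = E r * T := fun r hr =>
    permSym_upperSlots_absorb (signTwist ρ) hT' hr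
  -- under `φ(· T)`, a left factor `H r` may be duplicated on the right
  have dupH : ∀ r ≤ k, ∀ X, φ (H r * X * H r * T) = φ (H r * X * T) := fun r hr X => by
    have h1 : φ (H r * X * T) = φ (X * (T * H r)) := by
      rw [mul_assoc, cycH, mul_assoc]
    rw [h1, ← absH r hr, mul_assoc, mul_assoc, cycH]
    simp only [mul_assoc]
  have dupE : ∀ r ≤ k, ∀ X, φ (E r * X * E r * T) = φ (X * E r * T) := fun r hr X => by
    rw [mul_assoc X, ← absE r hr]
    simp only [mul_assoc]
    rw [cycE]
    simp only [mul_assoc]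
  have comm : ∀ r, H r * E r = E r * H r := fun r => permSym_commute ρ disjoint_slots
  set Z : ℕ → V := fun j => φ (H j * E (j - 1) * T) with hZ
  have H1 : H 0 = 1 ∧ H 1 = 1 := by
    have h := lowerSlots_succ (k := k) (r := 0) hk
    simp only [hH, lowerSlots_zero, permSym_empty, true_and]
    rw [h, lowerSlots_zero, insert_empty_eq, permSym_singleton]
  have E1 : E k = 1 ∧ E (k - 1) = 1 := by
    have h := upperSlots_eq_insert (k := k) (r := k - 1) (by omega)
    rw [Nat.sub_add_cancel hk, upperSlots_self, insert_empty_eq] at h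
    simp only [hE, upperSlots_self, permSym_empty, true_and]
    rw [h, permSym_singleton]
  have key : ∀ r ≤ k, (k : ℂ) • φ (H r * E r * T) =
      (((r : ℂ) + 1) * (k - r)) • Z (r + 1) + ((r : ℂ) * (k - r + 1)) • Z r := by
    intro r hr
    rcases Nat.eq_zero_or_pos r with rfl | hr0
    · simp [hZ, H1.1, H1.2]
    rcases hr.eq_or_lt with rfl | hrk
    · simp [hZ, E1.1, E1.2]
    obtain ⟨s, rfl⟩ : ∃ s, r = s + 1 := ⟨r - 1, by omega⟩
    set a : Fin k := ⟨s, by omega⟩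
    set b : Fin k := ⟨s + 1, hrk⟩
    have hab : a ≠ b := by simp [a, b]
    set p : V := φ (H (s + 1) * ρ (Equiv.swap a b) * E (s + 1) * T) with hp
    have recH : (((s + 1 : ℕ) : ℂ) + 1) • H (s + 2) =
        H (s + 1) + ((s + 1 : ℕ) : ℂ) • (H (s + 1) * ρ (Equiv.swap a b) * H (s + 1)) := by
      have := permSym_insert_eq ρ (S := lowerSlots k (s + 1)) (s := a) (t := b)
        (by simp [mem_lowerSlots, a]) (by simp [mem_lowerSlots, b])
      rw [card_lowerSlots hr, ← lowerSlots_succ hrk] at this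
      exact this
    have recE : ((k : ℂ) - ((s + 1 : ℕ) : ℂ) + 1) • E s =
        E (s + 1) - ((k : ℂ) - ((s + 1 : ℕ) : ℂ)) •
          (E (s + 1) * ρ (Equiv.swap a b) * E (s + 1)) := by
      have := permSym_insert_eq (signTwist ρ) (S := upperSlots k (s + 1)) (s := b) (t := a)
        (by simp [mem_upperSlots, b]) (by simp [mem_upperSlots, a])
      rw [card_upperSlots hr, ← upperSlots_eq_insert (by omega), Equiv.swap_comm,
        signTwist_swap ρ hab, Nat.cast_sub hr] at this
      simpa [sub_eq_add_neg] using this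
    have hZ1 : (((s + 1 : ℕ) : ℂ) + 1) • Z (s + 2) =
        φ (H (s + 1) * E (s + 1) * T) + ((s + 1 : ℕ) : ℂ) • p := by
      have h1 : Z (s + 2) = φ (H (s + 2) * E (s + 1) * T) := rfl
      rw [h1, ← map_smul, ← smul_mul_assoc, ← smul_mul_assoc, recH, add_mul, add_mul, map_add,
        smul_mul_assoc, smul_mul_assoc, map_smul, hp]
      have hdup := dupH _ hr (ρ (Equiv.swap a b) * E (s + 1))
      have hcomm : H (s + 1) * (E (s + 1) * T) = E (s + 1) * (H (s + 1) * T) := by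
        rw [← mul_assoc, comm, mul_assoc]
      simp only [mul_assoc] at hdup ⊢
      rw [← hcomm] at hdup
      rw [hdup]
    have hZ2 : ((k : ℂ) - ((s + 1 : ℕ) : ℂ) + 1) • Z (s + 1) =
        φ (H (s + 1) * E (s + 1) * T) - ((k : ℂ) - ((s + 1 : ℕ) : ℂ)) • p := by
      have h1 : Z (s + 1) = φ (H (s + 1) * E s * T) := rfl
      rw [h1, ← map_smul, ← smul_mul_assoc, ← mul_smul_comm, recE, mul_sub, sub_mul, map_sub,
        mul_smul_comm, smul_mul_assoc, map_smul, ← mul_assoc, ← mul_assoc, comm, hp]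
      have := dupE _ hr (H (s + 1) * ρ (Equiv.swap a b))
      simp only [mul_assoc] at this ⊢
      rw [this]
    rw [mul_comm ((((s + 1 : ℕ) : ℂ)) + 1), mul_smul, mul_smul, hZ1, hZ2]
    module
  have hk0 : (k : ℂ) ≠ 0 := by exact_mod_cast (by omega : k ≠ 0)
  refine (smul_eq_zero.1 (?_ : (k : ℂ) • (∑ r ∈ Finset.range (k + 1), ((-1 : ℂ) ^ r) •
    φ (H r * E r * T)) = 0)).resolve_left hk0
  rw [Finset.smul_sum]
  have hterm : ∀ r ∈ Finset.range (k + 1), (k : ℂ) • (-1 : ℂ) ^ r • φ (H r * E r * T) =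
      (-(-1 : ℂ) ^ (r + 1) * ((((r + 1 : ℕ) : ℂ)) * (k - ((r + 1 : ℕ) : ℂ) + 1))) • Z (r + 1) -
        (-(-1 : ℂ) ^ r * ((r : ℂ) * (k - r + 1))) • Z r := by
    intro r hr
    rw [smul_comm, key r (by simpa [Nat.lt_succ_iff] using hr), pow_succ]
    push_cast
    module
  rw [Finset.sum_congr rfl hterm, Finset.sum_range_sub
    (fun r => (-(-1 : ℂ) ^ r * ((r : ℂ) * (k - r + 1))) • Z r)]
  simp

end Symmetrizer

section Representation

variable {k N : ℕ}

theorem prod_pairs {f : Fin k → Fin k → ℂ} (hf : ∀ u, f u u = 1) :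
    ∏ p : Fin k × Fin k, f p.1 p.2 =
      ∏ p ∈ Finset.univ.filter (fun p : Fin k × Fin k => p.1 < p.2), f p.1 p.2 * f p.2 p.1 := by
  have h2 : ∏ p ∈ Finset.univ.filter (fun p : Fin k × Fin k => p.1 < p.2), f p.2 p.1 =
      ∏ p ∈ Finset.univ.filter (fun p : Fin k × Fin k => ¬ p.1 < p.2), f p.1 p.2 := by
    have h3 : ∏ p ∈ Finset.univ.filter (fun p : Fin k × Fin k => ¬ p.1 < p.2), f p.1 p.2 =
        ∏ p ∈ Finset.univ.filter (fun p : Fin k × Fin k => p.2 < p.1), f p.1 p.2 := by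
      refine (Finset.prod_subset (fun p => ?_) fun p hp hp' => ?_).symm
      · simp only [Finset.mem_filter, Finset.mem_univ, true_and]
        exact fun h => not_lt.2 h.le
      · simp only [Finset.mem_filter, Finset.mem_univ, true_and, not_lt] at hp hp'
        rw [le_antisymm hp hp', hf]
    rw [h3]
    exact Finset.prod_equiv (Equiv.prodComm _ _) (by simp) (by simp)
  rw [Finset.prod_mul_distrib, h2, Finset.prod_filter_mul_prod_filter_not]

/-- The inversion weights form a multiplicative cocycle. -/
theorem prod_inversions_mul (c : Fin k → Fin k → ℂ) (hc : ∀ u v, c u v * c v u = 1)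
    (σ τ : Equiv.Perm (Fin k)) :
    (∏ p ∈ Finset.univ.filter (fun p : Fin k × Fin k => p.1 < p.2 ∧ σ p.2 < σ p.1),
        c (τ⁻¹ p.1) (τ⁻¹ p.2)) *
      ∏ p ∈ Finset.univ.filter (fun p : Fin k × Fin k => p.1 < p.2 ∧ τ p.2 < τ p.1), c p.1 p.2 =
    ∏ p ∈ Finset.univ.filter (fun p : Fin k × Fin k => p.1 < p.2 ∧ (σ * τ) p.2 < (σ * τ) p.1),
        c p.1 p.2 := by
  have h1 : (∏ p ∈ Finset.univ.filter (fun p : Fin k × Fin k => p.1 < p.2 ∧ σ p.2 < σ p.1),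
        c (τ⁻¹ p.1) (τ⁻¹ p.2)) =
      ∏ p ∈ Finset.univ.filter
        (fun p : Fin k × Fin k => τ p.1 < τ p.2 ∧ σ (τ p.2) < σ (τ p.1)), c p.1 p.2 :=
    (Finset.prod_equiv (Equiv.prodCongr τ τ) (by simp) (by simp)).symm
  rw [h1]
  simp only [Finset.prod_filter]
  rw [← Finset.prod_mul_distrib,
    prod_pairs (f := fun u v => (if τ u < τ v ∧ σ (τ v) < σ (τ u) then c u v else 1) *
      (if u < v ∧ τ v < τ u then c u v else 1)) (by simp),
    prod_pairs (f := fun u v => if u < v ∧ (σ * τ) v < (σ * τ) u then c u v else 1) (by simp)]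
  refine Finset.prod_congr rfl fun p hp => ?_
  obtain ⟨u, v⟩ := p
  have huv : u < v := (Finset.mem_filter.1 hp).2
  have h2 : τ u ≠ τ v := fun h => huv.ne (τ.injective h)
  have h3 : σ (τ u) ≠ σ (τ v) := fun h => h2 (σ.injective h)
  simp only [huv, huv.not_gt, true_and, false_and, if_false, mul_one, Equiv.Perm.mul_apply]
  rcases lt_or_gt_of_ne h2 with h | h <;> rcases lt_or_gt_of_ne h3 with h' | h' <;>
    simp [h, h.not_gt, h', h'.not_gt, hc]

/-- The coefficient with which `P^q` exchanges the basis vectors `i` and `j`. -/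
noncomputable def exchangeWt (q : ℂ) (m : ℕ) (i j : Fin N) : ℂ :=
  q ^ eps i j * (-1 : ℂ) ^ (pa m i * pa m j)

theorem exchangeWt_mul_swap {q : ℂ} (hq : q ≠ 0) (m : ℕ) (i j : Fin N) :
    exchangeWt q m i j * exchangeWt q m j i = 1 := by
  have he : eps i j + eps j i = 0 := by
    unfold eps; split_ifs <;> omega
  rw [exchangeWt, exchangeWt, mul_mul_mul_comm, ← zpow_add₀ hq, he, zpow_zero, one_mul,
    mul_comm (pa m j), ← mul_pow]
  simp

theorem Pperm_apply_of_ne {q : ℂ} {m : ℕ} {σ : Equiv.Perm (Fin k)} {f g : Fin k → Fin N}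
    (h : f ≠ g ∘ ⇑σ⁻¹) : Pperm q m σ f g = 0 :=
  if_neg h

theorem Pperm_one (q : ℂ) (m : ℕ) :
    Pperm q m (1 : Equiv.Perm (Fin k)) = (1 : Matrix (Fin k → Fin N) (Fin k → Fin N) ℂ) := by
  ext f g
  have : Finset.univ.filter (fun p : Fin k × Fin k =>
      p.1 < p.2 ∧ (1 : Equiv.Perm (Fin k)) p.2 < (1 : Equiv.Perm (Fin k)) p.1) = ∅ := by
    refine Finset.filter_eq_empty_iff.2 fun p _ h => ?_
    exact lt_asymm h.1 h.2
  rw [Pperm, Matrix.of_apply, this, Finset.prod_empty, Matrix.one_apply]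
  simp

theorem Pperm_mul {q : ℂ} (hq : q ≠ 0) (m : ℕ) (σ τ : Equiv.Perm (Fin k)) :
    (Pperm q m (σ * τ) : Matrix (Fin k → Fin N) (Fin k → Fin N) ℂ) =
      Pperm q m σ * Pperm q m τ := by
  ext f g
  rw [Matrix.mul_apply, Finset.sum_eq_single (g ∘ ⇑τ⁻¹)]
  · have h := prod_inversions_mul (fun u v => exchangeWt q m (g u) (g v))
      (fun u v => exchangeWt_mul_swap hq m (g u) (g v)) σ τ
    simp only [exchangeWt] at h
    simp only [Pperm, Matrix.of_apply, if_true, ite_mul, zero_mul, Function.comp_apply]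
    rw [h, mul_inv_rev, Equiv.Perm.coe_mul, Function.comp_assoc]
  · intro h _ hne
    rw [Pperm_apply_of_ne hne, mul_zero]
  · simp

/-- The representation `σ ↦ P^q_σ`, with coefficients extended to `B`. -/
noncomputable def permRep {q : ℂ} (hq : q ≠ 0) (m N k : ℕ) (B : Type*) [Ring B] [Algebra ℂ B] :
    Equiv.Perm (Fin k) →* Matrix (Fin k → Fin N) (Fin k → Fin N) B where
  toFun σ := cmap (Pperm q m σ)
  map_one' := by
    rw [Pperm_one]
    exact map_one (algebraMap ℂ B).mapMatrix
  map_mul' σ τ := by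
    rw [Pperm_mul hq]
    exact map_mul (algebraMap ℂ B).mapMatrix _ _

theorem cmap_smul {I : Type*} {B : Type*} [Ring B] [Algebra ℂ B] (c : ℂ) (X : Matrix I I ℂ) :
    (cmap (c • X) : Matrix I I B) = c • cmap X := by
  ext f g
  simp [cmap, Algebra.smul_def]

theorem cmap_smul_sum {ι I : Type*} {B : Type*} [Ring B] [Algebra ℂ B] (c : ℂ) (s : Finset ι)
    (X : ι → Matrix I I ℂ) :
    (cmap (c • ∑ i ∈ s, X i) : Matrix I I B) = c • ∑ i ∈ s, cmap (X i) := by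
  ext f g
  simp [cmap, Matrix.sum_apply, Algebra.smul_def]

theorem cmap_HqS {q : ℂ} (hq : q ≠ 0) (m : ℕ) {B : Type*} [Ring B] [Algebra ℂ B]
    (S : Finset (Fin k)) :
    (cmap (HqS q m S) : Matrix (Fin k → Fin N) (Fin k → Fin N) B) =
      permSym (permRep hq m N k B) S :=
  cmap_smul_sum _ _ _

theorem cmap_AqS {q : ℂ} (hq : q ≠ 0) (m : ℕ) {B : Type*} [Ring B] [Algebra ℂ B]
    (S : Finset (Fin k)) :
    (cmap (AqS q m S) : Matrix (Fin k → Fin N) (Fin k → Fin N) B) =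
      permSym (signTwist (permRep hq m N k B)) S := by
  rw [AqS, cmap_smul_sum, permSym]
  congr 1
  exact Finset.sum_congr rfl fun σ _ => cmap_smul _ _

theorem Pperm_swap_apply (q : ℂ) (m : ℕ) {a b : Fin k} (hab : (a : ℕ) + 1 = b)
    (f g : Fin k → Fin N) :
    Pperm q m (Equiv.swap a b) f g =
      if f = g ∘ Equiv.swap a b then exchangeWt q m (g a) (g b) else 0 := by
  have : Finset.univ.filter (fun p : Fin k × Fin k =>
      p.1 < p.2 ∧ Equiv.swap a b p.2 < Equiv.swap a b p.1) = {(a, b)} := by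
    ext ⟨u, v⟩
    simp only [Finset.mem_filter, Finset.mem_univ, true_and, Finset.mem_singleton, Prod.mk.injEq,
      Equiv.swap_apply_def, Fin.lt_def, Fin.ext_iff]
    split_ifs <;> omega
  rw [Pperm, Matrix.of_apply, this, Finset.prod_singleton, Equiv.swap_inv]
  rfl

variable {B : Type*} [Ring B] [Algebra ℂ B]

theorem permRep_swap_mul_apply {q : ℂ} (hq : q ≠ 0) (m : ℕ) {a b : Fin k} (hab : (a : ℕ) + 1 = b)
    (X : Matrix (Fin k → Fin N) (Fin k → Fin N) B) (f g : Fin k → Fin N) :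
    (permRep hq m N k B (Equiv.swap a b) * X) f g =
      exchangeWt q m (f b) (f a) • X (f ∘ Equiv.swap a b) g := by
  have hs : (f ∘ Equiv.swap a b) ∘ Equiv.swap a b = f := by ext t; simp
  rw [Matrix.mul_apply, Finset.sum_eq_single (f ∘ Equiv.swap a b)]
  · simp [permRep, cmap, Pperm_swap_apply q m hab, hs, Algebra.smul_def]
  · intro h _ hne
    have : f ≠ h ∘ Equiv.swap a b := by
      rintro rfl
      exact hne (by ext t; simp)
    simp [permRep, cmap, Pperm_swap_apply q m hab, this]
  · simp

theorem mul_permRep_swap_apply {q : ℂ} (hq : q ≠ 0) (m : ℕ) {a b : Fin k} (hab : (a : ℕ) + 1 = b)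
    (X : Matrix (Fin k → Fin N) (Fin k → Fin N) B) (f g : Fin k → Fin N) :
    (X * permRep hq m N k B (Equiv.swap a b)) f g =
      exchangeWt q m (g a) (g b) • X f (g ∘ Equiv.swap a b) := by
  rw [Matrix.mul_apply, Finset.sum_eq_single (g ∘ Equiv.swap a b)]
  · simp [permRep, cmap, Pperm_swap_apply q m hab, Algebra.smul_def, Algebra.commutes]
  · intro h _ hne
    simp [permRep, cmap, Pperm_swap_apply q m hab, hne]
  · simp

theorem one_sub_mul_one_add_apply {q : ℂ} (hq : q ≠ 0) (m : ℕ) {a b : Fin k}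
    (hab : (a : ℕ) + 1 = b) (X : Matrix (Fin k → Fin N) (Fin k → Fin N) B)
    (f g : Fin k → Fin N) :
    ((1 - permRep hq m N k B (Equiv.swap a b)) * X * (1 + permRep hq m N k B (Equiv.swap a b))) f g
      = X f g + exchangeWt q m (g a) (g b) • X f (g ∘ Equiv.swap a b) -
        exchangeWt q m (f b) (f a) • (X (f ∘ Equiv.swap a b) g +
          exchangeWt q m (g a) (g b) • X (f ∘ Equiv.swap a b) (g ∘ Equiv.swap a b)) := by
  have h : (1 - permRep hq m N k B (Equiv.swap a b)) * X *
      (1 + permRep hq m N k B (Equiv.swap a b)) =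
      (X + X * permRep hq m N k B (Equiv.swap a b)) -
        permRep hq m N k B (Equiv.swap a b) * (X + X * permRep hq m N k B (Equiv.swap a b)) := by
    noncomm_ring
  rw [h, Matrix.sub_apply, permRep_swap_mul_apply hq m hab, Matrix.add_apply, Matrix.add_apply,
    mul_permRep_swap_apply hq m hab, mul_permRep_swap_apply hq m hab]

/-- The supertrace as a linear map. -/
noncomputable def strLinear (m N k : ℕ) (B : Type*) [Ring B] [Algebra ℂ B] :
    Matrix (Fin k → Fin N) (Fin k → Fin N) B →ₗ[ℂ] B where
  toFun := strAll m
  map_add' X Y := by simp [strAll, Finset.sum_add_distrib]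
  map_smul' c X := by simp [strAll, Finset.smul_sum, smul_comm c]

theorem strLinear_permRep_mul {q : ℂ} (hq : q ≠ 0) (m : ℕ) (σ : Equiv.Perm (Fin k))
    (X : Matrix (Fin k → Fin N) (Fin k → Fin N) B) :
    strLinear m N k B (permRep hq m N k B σ * X) =
      strLinear m N k B (X * permRep hq m N k B σ) := by
  change strAll m _ = strAll m _
  simp only [strAll, Matrix.mul_apply, Finset.smul_sum]
  rw [Finset.sum_comm]
  refine Finset.sum_congr rfl fun h _ => Finset.sum_congr rfl fun f _ => ?_
  change _ • (algebraMap ℂ B (Pperm q m σ f h) * _) = _ • (_ * algebraMap ℂ B (Pperm q m σ f h))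
  rw [Algebra.commutes]
  by_cases hfh : f = h ∘ ⇑σ⁻¹
  · have : ∑ t, pa m (f t) = ∑ t, pa m (h t) := by
      rw [hfh]
      exact Equiv.sum_comp σ⁻¹ fun t => pa m (h t)
    rw [this]
  · rw [Pperm_apply_of_ne hfh, map_zero, mul_zero, smul_zero, smul_zero]

end Representation

section Slots

variable {k N : ℕ} {B : Type*} [Ring B] [Algebra ℂ B]

/-- The entries of `M₁ M₂` on the tensor square. -/
noncomputable def pairEntry (m : ℕ) (M : Matrix (Fin N) (Fin N) B) (i i' j j' : Fin N) : B :=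
  ((-1 : ℂ) ^ (pa m i * pa m j + pa m j + pa m i' * pa m j' + pa m j' +
    (pa m i' + pa m j') * pa m j)) • (M i j * M i' j')

theorem Mslot_mul_Mslot_apply (m : ℕ) (M : Matrix (Fin N) (Fin N) B) {a b : Fin k}
    (hab : (a : ℕ) + 1 = b) (f g : Fin k → Fin N) :
    (Mslot m M a * Mslot m M b) f g =
      if ∀ t, t ≠ a → t ≠ b → f t = g t then
        ((-1 : ℂ) ^ ((pa m (f a) + pa m (f b) + (pa m (g a) + pa m (g b))) *
          ∑ t ∈ Finset.univ.filter (fun t => t < a), pa m (g t))) •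
          pairEntry m M (f a) (f b) (g a) (g b)
      else 0 := by
  have hne : a ≠ b := fun h => by rw [h] at hab; omega
  have hlt : Finset.univ.filter (fun t : Fin k => t < b) =
      insert a (Finset.univ.filter (fun t : Fin k => t < a)) := by
    ext t
    simp only [Finset.mem_filter, Finset.mem_univ, true_and, Finset.mem_insert, Fin.lt_def,
      Fin.ext_iff]
    omega
  rw [Matrix.mul_apply, Finset.sum_eq_single (Function.update f a (g a))]
  · have h1 : ∀ t, t ≠ a → f t = Function.update f a (g a) t := fun t ht => by simp [ht]
    have h2 : (∀ t, t ≠ b → Function.update f a (g a) t = g t) ↔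
        ∀ t, t ≠ a → t ≠ b → f t = g t := by
      refine ⟨fun h t ha hb => by simpa [ha] using h t hb, fun h t hb => ?_⟩
      by_cases ha : t = a
      · simp [ha]
      · simpa [ha] using h t ha hb
    simp only [Mslot, Matrix.of_apply]
    rw [if_pos h1]
    simp only [h2]
    split_ifs with h
    · have h3 : ∑ t ∈ Finset.univ.filter (fun t => t < a), pa m (Function.update f a (g a) t) =
          ∑ t ∈ Finset.univ.filter (fun t => t < a), pa m (g t) := by
        refine Finset.sum_congr rfl fun t ht => ?_
        have hta : t < a := (Finset.mem_filter.1 ht).2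
        have htb : t ≠ b := by rintro rfl; rw [Fin.lt_def] at hta; omega
        rw [Function.update_of_ne hta.ne, h t hta.ne htb]
      rw [h3, hlt, Finset.sum_insert (by simp), Function.update_self,
        Function.update_of_ne hne.symm, pairEntry, smul_mul_smul_comm, smul_smul, ← pow_add,
        ← pow_add]
      congr 2
      ring
    · simp
  · intro h _ hh
    simp only [Mslot, Matrix.of_apply]
    by_cases h1 : ∀ t, t ≠ a → f t = h t
    · rw [if_neg (c := ∀ t, t ≠ b → h t = g t), mul_zero]
      refine fun h2 => hh ?_
      ext t
      by_cases ht : t = a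
      · subst ht; simp [h2 t hne]
      · simp [ht, h1 t ht]
    · rw [if_neg h1, zero_mul]
  · simp

theorem permRep_swap_commute_Mslot {q : ℂ} (hq : q ≠ 0) (m : ℕ) (M : Matrix (Fin N) (Fin N) B)
    {a b c : Fin k} (hab : (a : ℕ) + 1 = b) (hca : c ≠ a) (hcb : c ≠ b) :
    Commute (permRep hq m N k B (Equiv.swap a b)) (Mslot m M c) := by
  ext f g
  rw [permRep_swap_mul_apply hq m hab, mul_permRep_swap_apply hq m hab]
  have hc : Equiv.swap a b c = c := Equiv.swap_apply_of_ne_of_ne hca hcb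
  have hiff : (∀ t, t ≠ c → (f ∘ Equiv.swap a b) t = g t) ↔
      ∀ t, t ≠ c → f t = (g ∘ Equiv.swap a b) t := by
    refine ⟨fun h t ht => ?_, fun h t ht => ?_⟩
    · have := h (Equiv.swap a b t) (fun h' => ht (by rw [← hc, ← h', Equiv.swap_apply_self]))
      simpa using this
    · have := h (Equiv.swap a b t) (fun h' => ht (by rw [← hc, ← h', Equiv.swap_apply_self]))
      simpa using this
  simp only [Mslot, Matrix.of_apply, hiff]
  split_ifs with h
  · have ha : f a = g b := by simpa using h a hca.symm
    have hb : f b = g a := by simpa using h b hcb.symm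
    have hsum : ∑ t ∈ Finset.univ.filter (fun t => t < c), pa m ((g ∘ Equiv.swap a b) t) =
        ∑ t ∈ Finset.univ.filter (fun t => t < c), pa m (g t) := by
      refine Finset.sum_equiv (Equiv.swap a b) (fun t => ?_) (fun t _ => rfl)
      simp only [Finset.mem_filter, Finset.mem_univ, true_and, Equiv.swap_apply_def, Fin.lt_def]
      rw [ne_eq, Fin.ext_iff] at hca hcb
      split_ifs with h1 h2
      · subst h1; omega
      · subst h2; omega
      · rfl
    rw [hsum, ha, hb, Function.comp_apply, Function.comp_apply, hc]
  · simp

theorem pairEntry_relation {q : ℂ} (hq : q ≠ 0) (m : ℕ) {M : Matrix (Fin N) (Fin N) B}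
    (hM : IsManin2 q m M) (i i' j j' : Fin N) :
    pairEntry m M i i' j j' + exchangeWt q m j j' • pairEntry m M i i' j' j -
      exchangeWt q m i' i • (pairEntry m M i' i j j' +
        exchangeWt q m j j' • pairEntry m M i' i j' j) = 0 := by
  have huniv : (Finset.univ : Finset (Fin 2)) = insert 1 {0} := by decide
  have hsym : ∀ ρ : Equiv.Perm (Fin 2) →* Matrix (Fin 2 → Fin N) (Fin 2 → Fin N) B,
      (2 : ℂ) • permSym ρ Finset.univ = 1 + ρ (Equiv.swap 0 1) := by
    intro ρ
    have h := permSym_insert ρ (S := {(0 : Fin 2)}) (t := 1) (by simp)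
    have h1 : ρ (Equiv.refl (Fin 2)) = 1 := map_one ρ
    rw [← huniv, permSym_singleton, huniv, Finset.sum_insert (by simp), ← huniv] at h
    rw [Finset.sum_singleton, Equiv.swap_self, h1, mul_one, mul_one] at h
    rw [← h]
    norm_num
  have hrel : (1 - permRep hq m N 2 B (Equiv.swap 0 1)) * (Mslot m M 0 * Mslot m M 1) *
      (1 + permRep hq m N 2 B (Equiv.swap 0 1)) = 0 := by
    rw [IsManin2, cmap_AqS hq, cmap_HqS hq] at hM
    rw [sub_eq_add_neg, ← signTwist_swap _ (by decide), ← hsym, ← hsym, mul_smul_comm,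
      smul_mul_assoc, smul_mul_assoc, ← mul_assoc, hM, smul_zero, smul_zero]
  have h := congrFun (congrFun hrel ![i, i']) ![j, j']
  rw [one_sub_mul_one_add_apply hq m (by rfl)] at h
  have hall : ∀ f g : Fin 2 → Fin N, ∀ t, t ≠ 0 → t ≠ 1 → f t = g t := by
    intro f g t h0 h1
    fin_cases t
    · exact absurd rfl h0
    · exact absurd rfl h1
  simp only [Mslot_mul_Mslot_apply m M (show ((0 : Fin 2) : ℕ) + 1 = (1 : Fin 2) from rfl)] at h
  simpa [hall, Finset.filter_false_of_mem] using h

theorem Mslot_pair_relation {q : ℂ} (hq : q ≠ 0) (m : ℕ) {M : Matrix (Fin N) (Fin N) B}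
    (hM : IsManin2 q m M) {a b : Fin k} (hab : (a : ℕ) + 1 = b) :
    (1 - permRep hq m N k B (Equiv.swap a b)) * (Mslot m M a * Mslot m M b) *
      (1 + permRep hq m N k B (Equiv.swap a b)) = 0 := by
  ext f g
  rw [one_sub_mul_one_add_apply hq m hab]
  simp only [Mslot_mul_Mslot_apply m M hab]
  have hs : ∀ t, t ≠ a → t ≠ b → Equiv.swap a b t = t := fun t =>
    Equiv.swap_apply_of_ne_of_ne
  have hf : ∀ t, t ≠ a → t ≠ b → (f ∘ Equiv.swap a b) t = f t := fun t ha hb => by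
    simp [hs t ha hb]
  have hg : ∀ t, t ≠ a → t ≠ b → (g ∘ Equiv.swap a b) t = g t := fun t ha hb => by
    simp [hs t ha hb]
  have e1 : (∀ t, t ≠ a → t ≠ b → f t = (g ∘ Equiv.swap a b) t) ↔
      ∀ t, t ≠ a → t ≠ b → f t = g t :=
    forall_congr' fun t => forall₂_congr fun ha hb => by rw [hg t ha hb]
  have e2 : (∀ t, t ≠ a → t ≠ b → (f ∘ Equiv.swap a b) t = g t) ↔
      ∀ t, t ≠ a → t ≠ b → f t = g t :=
    forall_congr' fun t => forall₂_congr fun ha hb => by rw [hf t ha hb]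
  have e3 : (∀ t, t ≠ a → t ≠ b → (f ∘ Equiv.swap a b) t = (g ∘ Equiv.swap a b) t) ↔
      ∀ t, t ≠ a → t ≠ b → f t = g t :=
    forall_congr' fun t => forall₂_congr fun ha hb => by rw [hf t ha hb, hg t ha hb]
  have hsum : ∑ t ∈ Finset.univ.filter (fun t => t < a), pa m ((g ∘ Equiv.swap a b) t) =
      ∑ t ∈ Finset.univ.filter (fun t => t < a), pa m (g t) := by
    refine Finset.sum_congr rfl fun t ht => ?_
    have hta : t < a := (Finset.mem_filter.1 ht).2
    rw [hg t hta.ne (by rintro rfl; rw [Fin.lt_def] at hta; omega)]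
  simp only [e1, e2, e3, hsum]
  split_ifs with h
  · simp only [Function.comp_apply, Equiv.swap_apply_left, Equiv.swap_apply_right]
    rw [add_comm (pa m (f b)), add_comm (pa m (g b))]
    set ε : ℂ := (-1 : ℂ) ^ ((pa m (f a) + pa m (f b) + (pa m (g a) + pa m (g b))) *
          ∑ t ∈ Finset.univ.filter (fun t => t < a), pa m (g t))
    have := congrArg (ε • ·) (pairEntry_relation hq m hM (f a) (f b) (g a) (g b))
    simp only [smul_zero] at this
    rw [Matrix.zero_apply, ← this]
    module
  · simp

theorem MProd_relation {q : ℂ} (hq : q ≠ 0) (m : ℕ) {M : Matrix (Fin N) (Fin N) B}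
    (hM : IsManin2 q m M) {a b : Fin k} (hab : (a : ℕ) + 1 = b) :
    (1 - permRep hq m N k B (Equiv.swap a b)) * MProd m M k *
      (1 + permRep hq m N k B (Equiv.swap a b)) = 0 := by
  set P := permRep hq m N k B (Equiv.swap a b) with hP
  set l := List.ofFn fun c : Fin k => Mslot m M c with hl
  have hlen : l.length = k := by simp [hl]
  have ha : (a : ℕ) < l.length := by omega
  have hb : (a : ℕ) + 1 < l.length := by omega
  have hla : l[(a : ℕ)] = Mslot m M a := by simp [hl]
  have hlb : l[(a : ℕ) + 1] = Mslot m M b := by simp [hl, hab]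
  have hsplit : MProd m M k =
      (l.take a).prod * (Mslot m M a * Mslot m M b) * (l.drop (a + 1 + 1)).prod := by
    change l.prod = _
    conv_lhs => rw [← List.take_append_drop a l, List.drop_eq_getElem_cons ha,
      List.drop_eq_getElem_cons hb, hla, hlb]
    simp only [List.prod_append, List.prod_cons, mul_assoc]
  have hL : Commute P (l.take a).prod := by
    refine Commute.list_prod_right _ _ fun x hx => ?_
    obtain ⟨i, hi, rfl⟩ := List.mem_take_iff_getElem.1 hx
    have hia : i < a := by omega
    simp only [hl, List.getElem_ofFn]
    exact permRep_swap_commute_Mslot hq m M hab (by rw [ne_eq, Fin.ext_iff]; simp; omega)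
      (by rw [ne_eq, Fin.ext_iff]; simp; omega)
  have hR : Commute P (l.drop (a + 1 + 1)).prod := by
    refine Commute.list_prod_right _ _ fun x hx => ?_
    obtain ⟨i, hi, rfl⟩ := List.mem_drop_iff_getElem.1 hx
    simp only [hl, List.getElem_ofFn]
    exact permRep_swap_commute_Mslot hq m M hab (by rw [ne_eq, Fin.ext_iff]; simp; omega)
      (by rw [ne_eq, Fin.ext_iff]; simp; omega)
  have hL' : (1 - P) * (l.take a).prod = (l.take a).prod * (1 - P) :=
    ((Commute.one_left _).sub_left hL).eq
  have hR' : (l.drop (a + 1 + 1)).prod * (1 + P) = (1 + P) * (l.drop (a + 1 + 1)).prod :=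
    ((Commute.one_left _).add_left hR).symm.eq
  calc (1 - P) * MProd m M k * (1 + P)
      = ((1 - P) * (l.take a).prod) * (Mslot m M a * Mslot m M b) *
          ((l.drop (a + 1 + 1)).prod * (1 + P)) := by rw [hsplit]; simp only [mul_assoc]
    _ = (l.take a).prod * ((1 - P) * (Mslot m M a * Mslot m M b) * (1 + P)) *
          (l.drop (a + 1 + 1)).prod := by rw [hL', hR']; simp only [mul_assoc]
    _ = 0 := by rw [Mslot_pair_relation hq m hM hab, mul_zero, zero_mul]

end Slots

/-- MacMahon Master Theorem, first form. -/
theorem stmt10 (m n k : ℕ) (hk : 1 ≤ k) (q : ℂ) (hq : q ≠ 0)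
    (A : Type*) [Ring A] [Algebra ℂ A]
    (M : Matrix (Fin (m + n)) (Fin (m + n)) A) (hM : IsManin2 q m M) :
    ∑ r ∈ Finset.range (k + 1), ((-1 : ℂ) ^ r) •
      strAll m (cmap (HqS q m (Finset.univ.filter fun t : Fin k => (t : ℕ) < r)) *
        cmap (AqS q m (Finset.univ.filter fun t : Fin k => r ≤ (t : ℕ))) *
        MProd m M k) = 0 := by
  have h := alternating_sum_permSym_eq_zero (strLinear m (m + n) k A)
    (permRep hq m (m + n) k A) (MProd m M k) hk (strLinear_permRep_mul hq m)
    fun a b hab => MProd_relation hq m hM hab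
  simp only [cmap_HqS hq, cmap_AqS hq]
  exact h

end QSM
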